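/- (Theorem 2(b)) Consider the distributed gradient-tracking algorithm with each f_i convex and β-smooth (β > 0), and suppose f attains its minimum at some point x*. If 0 < η ≤ (1−σ)²/(160β), then for every t ≥ 1 the consensus error satisfies min_{0 ≤ k ≤ t} ‖x(k) − 𝟙x̄(k)‖² ≤ (1/t) · { (1740/(1−σ)⁴) · [ (1/β)‖s(0) − 𝟙g(0)‖ + 2‖x(0) − 𝟙x̄(0)‖ ]² + (24/(1−σ)²) · n‖x̄(0) − x*‖² }. -/

import Mathlib

open scoped BigOperators RealInnerProductSpace
open Filter

noncomputable section

abbrev Vec (N : ℕ) := EuclideanSpace ℝ (Fin N)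

/-- Frobenius norm of a stacked matrix in `ℝ^{n×N}`, viewed as `n` rows in `ℝ^N`. -/
def fro {n N : ℕ} (A : Fin n → Vec N) : ℝ := Real.sqrt (∑ i, ‖A i‖ ^ 2)

/-- Spectral norm (largest singular value) of a square real matrix, as the operator norm
of the induced linear map between Euclidean spaces. -/
def specNorm {n : ℕ} (M : Matrix (Fin n) (Fin n) ℝ) : ℝ :=
  ‖LinearMap.toContinuousLinearMap (Matrix.toEuclideanLin M)‖

section VectorIdentities

variable {ι E : Type*} [Fintype ι] [NormedAddCommGroup E]

lemma norm_add_sq_le_div_add_div {σ : ℝ} (h0 : 0 < σ) (h1 : σ < 1) (p q : E) :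
    ‖p + q‖ ^ 2 ≤ ‖p‖ ^ 2 / σ + ‖q‖ ^ 2 / (1 - σ) := by
  have h1' : 0 < 1 - σ := by linarith
  have hle : ‖p + q‖ ^ 2 ≤ (‖p‖ + ‖q‖) ^ 2 := by
    gcongr
    exact norm_add_le p q
  have hid : ‖p‖ ^ 2 / σ + ‖q‖ ^ 2 / (1 - σ) - (‖p‖ + ‖q‖) ^ 2
      = ((1 - σ) * ‖p‖ - σ * ‖q‖) ^ 2 / (σ * (1 - σ)) := by
    field_simp
    ring
  have : 0 ≤ ((1 - σ) * ‖p‖ - σ * ‖q‖) ^ 2 / (σ * (1 - σ)) := by positivity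
  linarith

lemma sum_norm_add_sq_le {σ : ℝ} (h0 : 0 < σ) (h1 : σ < 1) (p q : ι → E) :
    ∑ i, ‖p i + q i‖ ^ 2 ≤ (∑ i, ‖p i‖ ^ 2) / σ + (∑ i, ‖q i‖ ^ 2) / (1 - σ) := by
  rw [Finset.sum_div, Finset.sum_div, ← Finset.sum_add_distrib]
  exact Finset.sum_le_sum fun i _ => norm_add_sq_le_div_add_div h0 h1 _ _

lemma norm_sub_sub_sub_sq_le (p q r w : E) :
    ‖p - q - r - w‖ ^ 2 ≤ 4 * (‖p‖ ^ 2 + ‖q‖ ^ 2 + ‖r‖ ^ 2 + ‖w‖ ^ 2) := by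
  have h : ‖p - q - r - w‖ ≤ ‖p‖ + ‖q‖ + ‖r‖ + ‖w‖ := by
    linarith [norm_sub_le (p - q - r) w, norm_sub_le (p - q) r, norm_sub_le p q]
  calc ‖p - q - r - w‖ ^ 2 ≤ (‖p‖ + ‖q‖ + ‖r‖ + ‖w‖) ^ 2 := by gcongr
    _ ≤ _ := by
      nlinarith [sq_nonneg (‖p‖ - ‖q‖), sq_nonneg (‖p‖ - ‖r‖), sq_nonneg (‖p‖ - ‖w‖),
        sq_nonneg (‖q‖ - ‖r‖), sq_nonneg (‖q‖ - ‖w‖), sq_nonneg (‖r‖ - ‖w‖)]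

lemma sum_norm_sub_sq_eq_of_sum_eq [InnerProductSpace ℝ E] {a : ι → E} {m : E}
    (hm : ∑ i, a i = (Fintype.card ι : ℝ) • m) (u : E) :
    ∑ i, ‖a i - u‖ ^ 2 = ∑ i, ‖a i - m‖ ^ 2 + (Fintype.card ι : ℝ) * ‖m - u‖ ^ 2 := by
  have h : ∀ i, ‖a i - u‖ ^ 2
      = ‖a i - m‖ ^ 2 + 2 * ⟪a i - m, m - u⟫ + ‖m - u‖ ^ 2 := fun i => by
    rw [← norm_add_sq_real, sub_add_sub_cancel]
  have hz : ∑ i, (a i - m) = 0 := by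
    simp [Finset.sum_sub_distrib, hm, Nat.cast_smul_eq_nsmul]
  simp_rw [h]
  rw [Finset.sum_add_distrib, Finset.sum_add_distrib, ← Finset.mul_sum, ← sum_inner, hz]
  simp

end VectorIdentities

section Gradient

variable {E : Type*} [NormedAddCommGroup E] [InnerProductSpace ℝ E] [CompleteSpace E]

lemma ConvexOn.inner_gradient_le_sub {f : E → ℝ} (hf : ConvexOn ℝ Set.univ f)
    (hd : Differentiable ℝ f) (u v : E) : ⟪gradient f u, v - u⟫ ≤ f v - f u := by
  have hc : ConvexOn ℝ Set.univ (f ∘ AffineMap.lineMap (k := ℝ) u v) :=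
    hf.comp_affineMap (AffineMap.lineMap u v)
  have hderiv : HasDerivAt (f ∘ AffineMap.lineMap (k := ℝ) u v)
      (fderiv ℝ f u (v - u)) 0 := by
    refine HasFDerivAt.comp_hasDerivAt (0 : ℝ) ?_ AffineMap.hasDerivAt_lineMap
    simpa using (hd u).hasFDerivAt
  have h := hc.le_slope_of_hasDerivAt (Set.mem_univ 0) (Set.mem_univ 1) one_pos hderiv
  rw [inner_gradient_left]
  simpa [slope_def_field] using h

lemma sub_le_inner_gradient_add {f : E → ℝ} {β : ℝ} (hf : ConvexOn ℝ Set.univ f)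
    (hd : Differentiable ℝ f)
    (hsm : ∀ u v, ‖gradient f u - gradient f v‖ ≤ β * ‖u - v‖) (x u z : E) :
    f u - f z ≤ ⟪gradient f x, u - z⟫ + β * ‖x - u‖ ^ 2 := by
  have h1 := hf.inner_gradient_le_sub hd u x
  have h2 := hf.inner_gradient_le_sub hd x z
  have h3 : ⟪gradient f u - gradient f x, u - x⟫ ≤ β * ‖x - u‖ ^ 2 := by
    calc _ ≤ ‖gradient f u - gradient f x‖ * ‖u - x‖ := real_inner_le_norm _ _
      _ ≤ (β * ‖u - x‖) * ‖u - x‖ := by gcongr; exact hsm u x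
      _ = _ := by rw [norm_sub_rev u x]; ring
  simp only [inner_sub_left, inner_sub_right] at *
  linarith

end Gradient

section Matrix

variable {n N : ℕ}

lemma fro_sq (A : Fin n → Vec N) : fro A ^ 2 = ∑ i, ‖A i‖ ^ 2 :=
  Real.sq_sqrt (Finset.sum_nonneg fun _ _ => sq_nonneg _)

lemma fro_nonneg (A : Fin n → Vec N) : 0 ≤ fro A := Real.sqrt_nonneg _

lemma sum_norm_sum_smul_sq_le (M : Matrix (Fin n) (Fin n) ℝ) (A : Fin n → Vec N) :
    ∑ i, ‖∑ j, M i j • A j‖ ^ 2 ≤ specNorm M ^ 2 * ∑ i, ‖A i‖ ^ 2 := by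
  have hcol : ∀ c : Fin N,
      ∑ i, (∑ j, M i j * A j c) ^ 2 ≤ specNorm M ^ 2 * ∑ i, A i c ^ 2 := fun c => by
    let v : EuclideanSpace ℝ (Fin n) := WithLp.toLp 2 fun j => A j c
    have h := (LinearMap.toContinuousLinearMap (Matrix.toEuclideanLin M)).le_opNorm v
    have h2 := pow_le_pow_left₀ (norm_nonneg _) h 2
    rw [mul_pow, EuclideanSpace.norm_sq_eq, EuclideanSpace.norm_sq_eq] at h2
    simpa [v, specNorm, Matrix.toLpLin_apply, Matrix.mulVec, dotProduct] using h2
  simp only [EuclideanSpace.norm_sq_eq, Real.norm_eq_abs, sq_abs]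
  rw [Finset.sum_comm, Finset.sum_comm (f := fun i c => A i c ^ 2), Finset.mul_sum]
  refine Finset.sum_le_sum fun c _ => ?_
  simpa using hcol c

lemma sum_norm_sum_smul_sq_le_of_sum_eq_zero (W : Matrix (Fin n) (Fin n) ℝ)
    {A : Fin n → Vec N} (hA : ∑ j, A j = 0) :
    ∑ i, ‖∑ j, W i j • A j‖ ^ 2
      ≤ specNorm (W - (n : ℝ)⁻¹ • Matrix.of (fun _ _ => (1 : ℝ))) ^ 2 * ∑ i, ‖A i‖ ^ 2 := by
  refine le_trans (le_of_eq ?_) (sum_norm_sum_smul_sq_le _ A)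
  refine Finset.sum_congr rfl fun i _ => ?_
  simp [sub_smul, Finset.sum_sub_distrib, ← Finset.smul_sum, hA]

end Matrix

/-- If the squared consensus error `e`, tracking error `y` and scaled gradient norm `G` satisfy
the coupled recursions of gradient tracking, then the partial sums of `e` are bounded, by the
potential `2 e / a + a y / (1000 β²) + r / 125`. -/
lemma sum_range_le_of_coupled_recursion {a β q η : ℝ} (ha0 : 0 < a) (ha1 : a < 1) (hβ : 0 < β)
    (hη : 0 < η) (hqη : q = η * β) (hq : q ≤ a ^ 2 / 160) {e y G r : ℕ → ℝ}
    (he0 : ∀ k, 0 ≤ e k) (hy0 : ∀ k, 0 ≤ y k) (hG0 : ∀ k, 0 ≤ G k) (hr0 : ∀ k, 0 ≤ r k)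
    (he : ∀ k, e (k + 1) ≤ (1 - a) * e k + η ^ 2 * y k / a)
    (hy : ∀ k, y (k + 1)
      ≤ (1 - a) * y k + β ^ 2 * (8 * e k + 4 * η ^ 2 * y k + 4 * G k) / a)
    (hG : ∀ k, (1 - 2 * q) * G k ≤ r k - r (k + 1) + 2 * q * e k) (t : ℕ) :
    ∑ k ∈ Finset.range t, e k ≤ 2 * e 0 / a + a * y 0 / (1000 * β ^ 2) + r 0 / 125 := by
  have hq0 : 0 < q := by rw [hqη]; positivity
  have hq1 : q ≤ 1 / 160 := by nlinarith
  have hq2 : q ^ 2 ≤ a ^ 4 / 25600 := by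
    calc q ^ 2 ≤ (a ^ 2 / 160) ^ 2 := by gcongr
      _ = _ := by ring
  obtain ⟨z, hz⟩ : ∃ z : ℕ → ℝ, ∀ k, y k = β ^ 2 * z k :=
    ⟨fun k => y k / β ^ 2, fun k => by field_simp⟩
  have hz0 : ∀ k, 0 ≤ z k := fun k => by
    have := hy0 k
    rw [hz] at this
    exact nonneg_of_mul_nonneg_right this (by positivity)
  have hstep : ∀ k, e k + (2 * e (k + 1) / a + a * z (k + 1) / 1000 + r (k + 1) / 125)
      ≤ 2 * e k / a + a * z k / 1000 + r k / 125 := fun k => by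
    have h1 : e (k + 1) ≤ (1 - a) * e k + q ^ 2 * z k / a := by
      have := he k
      rw [hz] at this
      calc _ ≤ _ := this
        _ = _ := by rw [hqη]; ring
    have h2 : a * z (k + 1) ≤ a * (1 - a) * z k + (8 * e k + 4 * q ^ 2 * z k + 4 * G k) := by
      have := hy k
      rw [hz, hz] at this
      have h : β ^ 2 * (a * z (k + 1))
          ≤ β ^ 2 * (a * (1 - a) * z k + (8 * e k + 4 * q ^ 2 * z k + 4 * G k)) := by
        calc _ = a * (β ^ 2 * z (k + 1)) := by ring
          _ ≤ a * _ := mul_le_mul_of_nonneg_left this ha0.le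
          _ = _ := by rw [hqη]; field_simp
      exact le_of_mul_le_mul_left h (by positivity)
    have h3 : G k ≤ 2 * (r k - r (k + 1)) + 4 * q * e k := by
      nlinarith [hG k, mul_nonneg (hG0 k) (show 0 ≤ 1 / 2 - 2 * q by linarith)]
    have h4 : 2 * e (k + 1) / a ≤ 2 * e k / a - 2 * e k + a ^ 2 / 12800 * z k := by
      have : 2 * e (k + 1) / a ≤ 2 * ((1 - a) * e k + a ^ 3 / 25600 * z k) / a := by
        gcongr
        refine h1.trans ?_
        have : q ^ 2 * z k / a ≤ a ^ 4 / 25600 * z k / a := by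
          gcongr
          exact hz0 k
        have h : a ^ 4 / 25600 * z k / a = a ^ 3 / 25600 * z k := by field_simp
        linarith
      refine this.trans (le_of_eq ?_)
      field_simp
      ring
    have h5 : q ^ 2 * z k ≤ a ^ 2 / 25600 * z k := by
      gcongr
      · exact hz0 k
      · nlinarith [sq_nonneg a]
    have h6 : q * e k ≤ 1 / 160 * e k := by
      gcongr
      exact he0 k
    nlinarith [he0 k, mul_nonneg (sq_nonneg a) (hz0 k)]
  have hind : ∀ t, ∑ k ∈ Finset.range t, e k
      + (2 * e t / a + a * z t / 1000 + r t / 125)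
      ≤ 2 * e 0 / a + a * z 0 / 1000 + r 0 / 125 := fun t => by
    induction t with
    | zero => simp
    | succ t ih =>
      rw [Finset.sum_range_succ]
      linarith [hstep t]
  have hlast : 0 ≤ 2 * e t / a + a * z t / 1000 + r t / 125 := by
    have := he0 t; have := hz0 t; have := hr0 t
    positivity
  have hy' : a * y 0 / (1000 * β ^ 2) = a * z 0 / 1000 := by
    rw [hz]
    field_simp
  linarith [hind t]

theorem statement12
    {n N : ℕ} (hn : 0 < n)
    (β : ℝ) (hβ : 0 < β)
    (f : Fin n → Vec N → ℝ)
    (hcvx : ∀ i, ConvexOn ℝ Set.univ (f i))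
    (hdiff : ∀ i, Differentiable ℝ (f i))
    (hsmooth : ∀ i, ∀ u v : Vec N,
      ‖gradient (f i) u - gradient (f i) v‖ ≤ β * ‖u - v‖)
    (favg : Vec N → ℝ) (hfavg : ∀ z, favg z = (n : ℝ)⁻¹ * ∑ i, f i z)
    (xstar : Vec N) (hmin : ∀ z, favg xstar ≤ favg z)
    (W : Matrix (Fin n) (Fin n) ℝ)
    (hWnonneg : ∀ i j, 0 ≤ W i j)
    (hWrow : ∀ i, ∑ j, W i j = 1)
    (hWcol : ∀ j, ∑ i, W i j = 1)
    (σ : ℝ)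
    (hσ : σ = specNorm (W - (n : ℝ)⁻¹ • Matrix.of (fun _ _ => (1 : ℝ))))
    (hσ0 : 0 < σ) (hσ1 : σ < 1)
    (η : ℝ) (hη0 : 0 < η) (hη1 : η ≤ (1 - σ) ^ 2 / (160 * β))
    (x s : ℕ → Fin n → Vec N)
    (hs0 : ∀ i, s 0 i = gradient (f i) (x 0 i))
    (hxupd : ∀ t i, x (t + 1) i = (∑ j, W i j • x t j) - η • s t i)
    (hsupd : ∀ t i, s (t + 1) i =
      (∑ j, W i j • s t j) + gradient (f i) (x (t + 1) i) - gradient (f i) (x t i))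
    (xbar g : ℕ → Vec N)
    (hxbar : ∀ t, xbar t = (n : ℝ)⁻¹ • ∑ i, x t i)
    (hg : ∀ t, g t = (n : ℝ)⁻¹ • ∑ i, gradient (f i) (x t i)) :
    ∀ t : ℕ, 1 ≤ t →
      ∃ k ≤ t,
        fro (fun i => x k i - xbar k) ^ 2 ≤
          (1 / (t : ℝ)) *
            (1740 / (1 - σ) ^ 4 *
                ((1 / β) * fro (fun i => s 0 i - g 0) +
                  2 * fro (fun i => x 0 i - xbar 0)) ^ 2 +
              24 / (1 - σ) ^ 2 * ((n : ℝ) * ‖xbar 0 - xstar‖ ^ 2)) := by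
  have hn' : (n : ℝ) ≠ 0 := by positivity
  have ha0 : 0 < 1 - σ := by linarith
  have hxsum : ∀ t, ∑ i, x t i = (Fintype.card (Fin n) : ℝ) • xbar t := fun t => by
    rw [hxbar, Fintype.card_fin, smul_inv_smul₀ hn']
  have hgsum : ∀ t, ∑ i, gradient (f i) (x t i) = (Fintype.card (Fin n) : ℝ) • g t := fun t => by
    rw [hg, Fintype.card_fin, smul_inv_smul₀ hn']
  have hWsum : ∀ v : Fin n → Vec N, ∑ i, ∑ j, W i j • v j = ∑ j, v j := fun v => by
    rw [Finset.sum_comm]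
    simp [← Finset.sum_smul, hWcol]
  have hssum : ∀ t, ∑ i, s t i = (Fintype.card (Fin n) : ℝ) • g t := fun t => by
    induction t with
    | zero => rw [← hgsum]; exact Finset.sum_congr rfl fun i _ => hs0 i
    | succ t ih =>
      simp_rw [hsupd, Finset.sum_sub_distrib, Finset.sum_add_distrib]
      rw [hWsum, ih, hgsum, hgsum]
      abel
  have hxbar_succ : ∀ t, xbar (t + 1) = xbar t - η • g t := fun t => by
    rw [hxbar (t + 1)]
    simp_rw [hxupd, Finset.sum_sub_distrib]
    rw [hWsum, ← Finset.smul_sum, hssum, hxsum, Fintype.card_fin, smul_comm η, ← smul_sub,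
      inv_smul_smul₀ hn']
  have hxc : ∀ t, ∑ i, (x t i - xbar t) = 0 := fun t => by
    simp [Finset.sum_sub_distrib, hxsum, Nat.cast_smul_eq_nsmul]
  have hsc : ∀ t, ∑ i, (s t i - g t) = 0 := fun t => by
    simp [Finset.sum_sub_distrib, hssum, Nat.cast_smul_eq_nsmul]
  have hWc : ∀ (i : Fin n) (v : Fin n → Vec N) (c : Vec N),
      ∑ j, W i j • (v j - c) = ∑ j, W i j • v j - c := fun i v c => by
    simp [smul_sub, Finset.sum_sub_distrib, ← Finset.sum_smul, hWrow]
  have hcontr : ∀ v : Fin n → Vec N, ∑ j, v j = 0 →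
      ∑ i, ‖∑ j, W i j • v j‖ ^ 2 ≤ σ ^ 2 * ∑ i, ‖v i‖ ^ 2 := fun v hv => by
    rw [hσ]
    exact sum_norm_sum_smul_sq_le_of_sum_eq_zero W hv
  set e : ℕ → ℝ := fun k => ∑ i, ‖x k i - xbar k‖ ^ 2 with he_def
  set y : ℕ → ℝ := fun k => ∑ i, ‖s k i - g k‖ ^ 2 with hy_def
  have he0 : ∀ k, 0 ≤ e k := fun k => Finset.sum_nonneg fun _ _ => sq_nonneg _
  have hy0 : ∀ k, 0 ≤ y k := fun k => Finset.sum_nonneg fun _ _ => sq_nonneg _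
  have he : ∀ k, e (k + 1) ≤ (1 - (1 - σ)) * e k + η ^ 2 * y k / (1 - σ) := fun k => by
    have hrow : ∀ i, x (k + 1) i - xbar (k + 1)
        = ∑ j, W i j • (x k j - xbar k) + -(η • (s k i - g k)) := fun i => by
      rw [hWc, hxupd, hxbar_succ, smul_sub]
      abel
    have h := sum_norm_add_sq_le hσ0 hσ1 (fun i => ∑ j, W i j • (x k j - xbar k))
      (fun i => -(η • (s k i - g k)))
    have hc := hcontr _ (hxc k)
    have h1 : (∑ i, ‖∑ j, W i j • (x k j - xbar k)‖ ^ 2) / σ ≤ σ * e k := by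
      rw [div_le_iff₀ hσ0]
      exact hc.trans (le_of_eq (by simp only [he_def]; ring))
    have h2 : ∑ i, ‖-(η • (s k i - g k))‖ ^ 2 = η ^ 2 * y k := by
      simp [hy_def, norm_smul, mul_pow, Finset.mul_sum]
    simp only [he_def, hrow]
    rw [h2] at h
    simp only [he_def] at h1
    linarith
  have hdiffx : ∀ k, ∑ i, ‖x (k + 1) i - x k i‖ ^ 2
      ≤ 8 * e k + 4 * η ^ 2 * y k + 4 * (η ^ 2 * ((n : ℝ) * ‖g k‖ ^ 2)) := fun k => by
    have hrow : ∀ i, x (k + 1) i - x k i = ∑ j, W i j • (x k j - xbar k) - (x k i - xbar k)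
        - η • (s k i - g k) - η • g k := fun i => by
      rw [hWc, hxupd, smul_sub]
      abel
    have hc := hcontr _ (hxc k)
    have hc' : σ ^ 2 * e k ≤ e k := mul_le_of_le_one_left (he0 k) (by nlinarith)
    calc ∑ i, ‖x (k + 1) i - x k i‖ ^ 2
        ≤ ∑ i, 4 * (‖∑ j, W i j • (x k j - xbar k)‖ ^ 2 + ‖x k i - xbar k‖ ^ 2
          + ‖η • (s k i - g k)‖ ^ 2 + ‖η • g k‖ ^ 2) := by
          refine Finset.sum_le_sum fun i _ => ?_
          rw [hrow]
          exact norm_sub_sub_sub_sq_le _ _ _ _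
      _ = 4 * (∑ i, ‖∑ j, W i j • (x k j - xbar k)‖ ^ 2 + e k + η ^ 2 * y k
          + η ^ 2 * ((n : ℝ) * ‖g k‖ ^ 2)) := by
          rw [← Finset.mul_sum]
          simp only [he_def, hy_def, Finset.sum_add_distrib, norm_smul, mul_pow, Finset.mul_sum,
            Real.norm_eq_abs, sq_abs, Finset.sum_const, Finset.card_univ, Fintype.card_fin,
            nsmul_eq_mul]
          ring
      _ ≤ _ := by linarith
  have hy : ∀ k, y (k + 1) ≤ (1 - (1 - σ)) * y k
      + β ^ 2 * (8 * e k + 4 * η ^ 2 * y k + 4 * (η ^ 2 * ((n : ℝ) * ‖g k‖ ^ 2))) / (1 - σ) :=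
    fun k => by
    set h : Fin n → Vec N := fun i => gradient (f i) (x (k + 1) i) - gradient (f i) (x k i)
      with h_def
    have hrow : ∀ i, s (k + 1) i - g (k + 1)
        = ∑ j, W i j • (s k j - g k) + (h i - (g (k + 1) - g k)) := fun i => by
      rw [hWc, hsupd]
      simp only [h_def]
      abel
    have hbound := sum_norm_add_sq_le hσ0 hσ1 (fun i => ∑ j, W i j • (s k j - g k))
      (fun i => h i - (g (k + 1) - g k))
    have h1 : (∑ i, ‖∑ j, W i j • (s k j - g k)‖ ^ 2) / σ ≤ σ * y k := by
      rw [div_le_iff₀ hσ0]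
      exact (hcontr _ (hsc k)).trans (le_of_eq (by simp only [hy_def]; ring))
    have hhsum : ∑ i, h i = (Fintype.card (Fin n) : ℝ) • (g (k + 1) - g k) := by
      simp only [h_def, Finset.sum_sub_distrib, hgsum, smul_sub]
    have h2 : ∑ i, ‖h i - (g (k + 1) - g k)‖ ^ 2 ≤ ∑ i, ‖h i‖ ^ 2 := by
      have hvar := sum_norm_sub_sq_eq_of_sum_eq hhsum 0
      simp only [sub_zero] at hvar
      rw [hvar]
      exact le_add_of_nonneg_right (by positivity)
    have h3 : ∑ i, ‖h i‖ ^ 2 ≤ β ^ 2 * ∑ i, ‖x (k + 1) i - x k i‖ ^ 2 := by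
      rw [Finset.mul_sum]
      refine Finset.sum_le_sum fun i _ => ?_
      rw [← mul_pow]
      exact pow_le_pow_left₀ (norm_nonneg _) (hsmooth i _ _) 2
    have h4 : (∑ i, ‖h i - (g (k + 1) - g k)‖ ^ 2) / (1 - σ)
        ≤ β ^ 2 * (8 * e k + 4 * η ^ 2 * y k + 4 * (η ^ 2 * ((n : ℝ) * ‖g k‖ ^ 2))) / (1 - σ) := by
      gcongr
      exact h2.trans (h3.trans (mul_le_mul_of_nonneg_left (hdiffx k) (by positivity)))
    simp only [hy_def, hrow]
    simp only [hy_def] at h1 h4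
    linarith
  have hG : ∀ k, (1 - 2 * (η * β)) * (η ^ 2 * ((n : ℝ) * ‖g k‖ ^ 2))
      ≤ (n : ℝ) * ‖xbar k - xstar‖ ^ 2 - (n : ℝ) * ‖xbar (k + 1) - xstar‖ ^ 2
        + 2 * (η * β) * e k := fun k => by
    have hsum : ∑ i, (f i (xbar (k + 1)) - f i xstar)
        ≤ ∑ i, (⟪gradient (f i) (x k i), xbar (k + 1) - xstar⟫
          + β * ‖x k i - xbar (k + 1)‖ ^ 2) :=
      Finset.sum_le_sum fun i _ => sub_le_inner_gradient_add (hcvx i) (hdiff i) (hsmooth i) _ _ _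
    have hpos : 0 ≤ ∑ i, (f i (xbar (k + 1)) - f i xstar) := by
      have := hmin (xbar (k + 1))
      rw [hfavg, hfavg] at this
      rw [Finset.sum_sub_distrib, sub_nonneg]
      exact le_of_mul_le_mul_left this (by positivity)
    have hstep : xbar k - xbar (k + 1) = η • g k := by
      rw [hxbar_succ]
      abel
    rw [Finset.sum_add_distrib, ← sum_inner, hgsum, ← Finset.mul_sum,
      sum_norm_sub_sq_eq_of_sum_eq (hxsum k), hstep, norm_smul, mul_pow, real_inner_smul_left,
      Fintype.card_fin, Real.norm_eq_abs, sq_abs] at hsum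
    have hr : ‖xbar k - xstar‖ ^ 2 = η ^ 2 * ‖g k‖ ^ 2
        + 2 * (η * ⟪g k, xbar (k + 1) - xstar⟫) + ‖xbar (k + 1) - xstar‖ ^ 2 := by
      rw [← sub_add_sub_cancel (xbar k) (xbar (k + 1)) xstar, norm_add_sq_real, hstep, norm_smul,
        mul_pow, real_inner_smul_left, Real.norm_eq_abs, sq_abs]
    have hfin := mul_nonneg hη0.le (hpos.trans hsum)
    rw [hr]
    simp only [he_def]
    linarith
  have hq : η * β ≤ (1 - σ) ^ 2 / 160 := by
    calc η * β ≤ (1 - σ) ^ 2 / (160 * β) * β := by gcongr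
      _ = _ := by field_simp
  have hmain := sum_range_le_of_coupled_recursion ha0 (by linarith) hβ hη0 rfl hq he0 hy0
    (fun k => by positivity) (r := fun k => (n : ℝ) * ‖xbar k - xstar‖ ^ 2)
    (fun k => by positivity) he hy hG
  intro t ht
  have ht0 : 0 < (t : ℝ) := by positivity
  obtain ⟨k, hk, hkmin⟩ := Finset.exists_min_image (Finset.range t) e ⟨0, by simpa using (show 0 < t from ht)⟩
  refine ⟨k, (Finset.mem_range.mp hk).le, ?_⟩
  rw [fro_sq, one_div_mul_eq_div, le_div_iff₀ ht0]
  have havg : e k * t ≤ ∑ j ∈ Finset.range t, e j := by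
    have := Finset.card_nsmul_le_sum (Finset.range t) e (e k) hkmin
    rw [Finset.card_range, nsmul_eq_mul] at this
    linarith
  refine havg.trans ((hmain t).trans ?_)
  have hinv4 : 1 / (1 - σ) ≤ 1 / (1 - σ) ^ 4 :=
    one_div_le_one_div_of_le (by positivity) (pow_le_of_le_one ha0.le (by linarith) (by norm_num))
  have hinv4' : 1 ≤ 1 / (1 - σ) ^ 4 := by
    rw [one_le_div (by positivity)]
    exact pow_le_one₀ ha0.le (by linarith)
  have hinv2 : 1 ≤ 1 / (1 - σ) ^ 2 := by
    rw [one_le_div (by positivity)]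
    exact pow_le_one₀ ha0.le (by linarith)
  set S := fro fun i => s 0 i - g 0
  set X := fro fun i => x 0 i - xbar 0
  have hS0 : 0 ≤ S := fro_nonneg _
  have hX0 : 0 ≤ X := fro_nonneg _
  have hyS : y 0 = S ^ 2 := (fro_sq _).symm
  have heX : e 0 = X ^ 2 := (fro_sq _).symm
  set Z := 1 / β * S with hZ
  have hZ0 : 0 ≤ Z := by positivity
  have h1 : 2 * e 0 / (1 - σ) ≤ 1 / (1 - σ) ^ 4 * (2 * X ^ 2) := by
    rw [heX, ← one_div_mul_eq_div]
    gcongr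
  have h2 : (1 - σ) * y 0 / (1000 * β ^ 2) ≤ 1 / (1 - σ) ^ 4 * Z ^ 2 := by
    have : (1 - σ) * y 0 / (1000 * β ^ 2) = (1 - σ) / 1000 * Z ^ 2 := by
      rw [hyS, hZ]
      field_simp
    rw [this]
    exact mul_le_mul_of_nonneg_right (by linarith) (sq_nonneg Z)
  have h3 : 1 / (1 - σ) ^ 4 * (2 * X ^ 2) + 1 / (1 - σ) ^ 4 * Z ^ 2
      ≤ 1740 / (1 - σ) ^ 4 * (Z + 2 * X) ^ 2 := by
    have : 1740 / (1 - σ) ^ 4 * (Z + 2 * X) ^ 2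
        = 1 / (1 - σ) ^ 4 * (1740 * (Z + 2 * X) ^ 2) := by ring
    rw [this, ← mul_add]
    gcongr
    nlinarith [mul_nonneg hZ0 hX0, sq_nonneg Z, sq_nonneg X]
  have h4 : (n : ℝ) * ‖xbar 0 - xstar‖ ^ 2 / 125
      ≤ 24 / (1 - σ) ^ 2 * ((n : ℝ) * ‖xbar 0 - xstar‖ ^ 2) := by
    have hR : 0 ≤ (n : ℝ) * ‖xbar 0 - xstar‖ ^ 2 := by positivity
    have : 24 / (1 - σ) ^ 2 = 24 * (1 / (1 - σ) ^ 2) := by ring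
    rw [this]
    nlinarith
  linarith
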